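/- arXiv:1806.01469 — 2 statements merged into one kernel-verified Lean document; each statement's English description precedes it below -/
import Mathlib

section
/- For every integer n ≥ 3, the normalizing factor satisfies Z < 1 / (4 · ln(n/2)). -/
open scoped Classical
open Finset

/-- Vertex set of the `n × n` torus. -/
abbrev Vx (n : ℕ) := Fin n × Fin n

/-- Toroidal distance on the `n × n` torus. -/
def tdist (n : ℕ) (u v : Vx n) : ℕ :=
  min ((u.1 : ℤ) - (v.1 : ℤ)).natAbs (n - ((u.1 : ℤ) - (v.1 : ℤ)).natAbs) +
  min ((u.2 : ℤ) - (v.2 : ℤ)).natAbs (n - ((u.2 : ℤ) - (v.2 : ℤ)).natAbs)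

/-- The normalizing factor at vertex `u`. -/
noncomputable def Zfac (n : ℕ) (u : Vx n) : ℝ :=
  (∑ w ∈ univ.filter (fun w => w ≠ u), ((tdist n u w : ℝ) ^ 2)⁻¹)⁻¹

/-- Translation of a point of the cycle `ℤ/n` by a signed offset shorter than half the cycle. -/
theorem exists_cycle_translate {n : ℕ} (x : Fin n) (a : ℤ) (ha : 2 * a.natAbs < n) :
    ∃ y : Fin n, (y : ℤ) - x = a ∨ (y : ℤ) - x = a + n ∨ (y : ℤ) - x = a - n := by
  have hx := x.isLt
  rcases lt_trichotomy 0 ((x : ℤ) + a) with h | h | h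
  · rcases lt_or_ge ((x : ℤ) + a) n with h' | h'
    · exact ⟨⟨((x : ℤ) + a).toNat, by omega⟩, by simp only; omega⟩
    · exact ⟨⟨((x : ℤ) + a - n).toNat, by omega⟩, by simp only; omega⟩
  · exact ⟨⟨0, by omega⟩, by simp only; omega⟩
  · exact ⟨⟨((x : ℤ) + a + n).toNat, by omega⟩, by simp only; omega⟩

theorem min_natAbs_of_cycle_translate {n : ℕ} {a : ℤ} {x y : Fin n} (ha : 2 * a.natAbs < n)
    (h : (y : ℤ) - x = a ∨ (y : ℤ) - x = a + n ∨ (y : ℤ) - x = a - n) :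
    min ((x : ℤ) - y).natAbs (n - ((x : ℤ) - y).natAbs) = a.natAbs := by
  omega

theorem eq_of_cycle_translate {n : ℕ} {a b x y : ℤ} (ha : 2 * a.natAbs < n)
    (hb : 2 * b.natAbs < n) (h : y - x = a ∨ y - x = a + n ∨ y - x = a - n)
    (h' : y - x = b ∨ y - x = b + n ∨ y - x = b - n) : a = b := by
  omega

/-- The `i`-th point on the `q`-th side of the `ℓ¹`-sphere of radius `d` in `ℤ²`. -/
def spherePoint (d : ℕ) (q : Fin 4) (i : Fin d) : ℤ × ℤ :=
  match q with
  | 0 => ((d : ℤ) - i, i)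
  | 1 => (-i, (d : ℤ) - i)
  | 2 => ((i : ℤ) - d, -i)
  | 3 => (i, (i : ℤ) - d)

theorem spherePoint_natAbs_add (d : ℕ) (q : Fin 4) (i : Fin d) :
    (spherePoint d q i).1.natAbs + (spherePoint d q i).2.natAbs = d := by
  have := i.isLt
  fin_cases q <;> simp only [spherePoint] <;> omega

theorem spherePoint_injective (d : ℕ) :
    Function.Injective fun p : Fin 4 × Fin d => spherePoint d p.1 p.2 := by
  rintro ⟨q, i⟩ ⟨r, j⟩ h
  have := i.isLt
  have := j.isLt
  fin_cases q <;> fin_cases r <;> simp only [spherePoint, Prod.mk.injEq] at h <;>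
    first
    | (exfalso; omega)
    | (simp only [Prod.mk.injEq, Fin.ext_iff, true_and]; omega)

/-- Spheres of radius below half the side length have at least `4 * d` points. -/
theorem four_mul_le_card_sphere {n d : ℕ} (hd : 2 * d < n) (u : Vx n) :
    4 * d ≤ (univ.filter fun w => tdist n u w = d).card := by
  have hq (p : Fin 4 × Fin d) := spherePoint_natAbs_add d p.1 p.2
  choose y₁ hy₁ using fun p : Fin 4 × Fin d =>
    exists_cycle_translate u.1 (spherePoint d p.1 p.2).1 (by have := hq p; omega)
  choose y₂ hy₂ using fun p : Fin 4 × Fin d =>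
    exists_cycle_translate u.2 (spherePoint d p.1 p.2).2 (by have := hq p; omega)
  have hcard : (univ : Finset (Fin 4 × Fin d)).card = 4 * d := by simp
  rw [← hcard]
  refine card_le_card_of_injOn (fun p => (y₁ p, y₂ p)) ?_ ?_
  · intro p _
    have hp := hq p
    refine mem_coe.mpr (mem_filter.mpr ⟨mem_univ _, ?_⟩)
    rw [tdist, min_natAbs_of_cycle_translate (by omega) (hy₁ p),
      min_natAbs_of_cycle_translate (by omega) (hy₂ p), hp]
  · intro p _ r _ h
    obtain ⟨h₁, h₂⟩ := Prod.mk.inj h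
    have hp := hq p
    have hr := hq r
    refine spherePoint_injective d (?_ : spherePoint d p.1 p.2 = spherePoint d r.1 r.2)
    exact Prod.ext
      (eq_of_cycle_translate (by omega) (by omega) (hy₁ p) (h₁ ▸ hy₁ r))
      (eq_of_cycle_translate (by omega) (by omega) (hy₂ p) (h₂ ▸ hy₂ r))

theorem log_add_two_lt_sum_inv (k : ℕ) :
    Real.log ((k : ℝ) + 2) < ∑ d ∈ Icc 1 (k + 1), (d : ℝ)⁻¹ := by
  induction k with
  | zero => simpa using Real.log_two_lt_d9.trans (by norm_num)
  | succ k ih =>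
    rw [sum_Icc_succ_top (by omega)]
    have hk : (0 : ℝ) < (k : ℝ) + 2 := by positivity
    have h := Real.log_le_sub_one_of_pos (x := ((k : ℝ) + 3) / (k + 2)) (by positivity)
    rw [Real.log_div (by positivity) hk.ne'] at h
    have h' : ((k : ℝ) + 3) / (k + 2) - 1 = ((k + 1 + 1 : ℕ) : ℝ)⁻¹ := by
      push_cast
      field_simp
      ring
    rw [h'] at h
    have h3 : ((k + 1 : ℕ) : ℝ) + 2 = k + 3 := by push_cast; ring
    rw [h3]
    linarith

theorem tdist_self (n : ℕ) (u : Vx n) : tdist n u u = 0 := by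
  simp [tdist]

/-- The sum of inverse squared distances dominates four times a harmonic sum. -/
theorem four_mul_sum_inv_le {n k : ℕ} (hk : 2 * k < n) (u : Vx n) :
    4 * ∑ d ∈ Icc 1 k, (d : ℝ)⁻¹ ≤
      ∑ w ∈ univ.filter (fun w => w ≠ u), ((tdist n u w : ℝ) ^ 2)⁻¹ := by
  calc
    4 * ∑ d ∈ Icc 1 k, (d : ℝ)⁻¹
      ≤ ∑ d ∈ Icc 1 k, ∑ w ∈ univ.filter (fun w => tdist n u w = d),
          ((tdist n u w : ℝ) ^ 2)⁻¹ := by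
        rw [mul_sum]
        refine sum_le_sum fun d hd => ?_
        rw [mem_Icc] at hd
        have hpos : (0 : ℝ) < d := by exact_mod_cast hd.1
        have hcard : ((4 * d : ℕ) : ℝ) ≤ (univ.filter fun w => tdist n u w = d).card := by
          exact_mod_cast four_mul_le_card_sphere (by omega) u
        rw [sum_congr rfl fun w hw => by rw [(mem_filter.mp hw).2], sum_const, nsmul_eq_mul]
        calc
          4 * (d : ℝ)⁻¹ = ((4 * d : ℕ) : ℝ) * ((d : ℝ) ^ 2)⁻¹ := by
            push_cast
            field_simp
          _ ≤ _ := by gcongr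
    _ = ∑ w ∈ (Icc 1 k).biUnion (fun d => univ.filter fun w => tdist n u w = d),
          ((tdist n u w : ℝ) ^ 2)⁻¹ := by
        refine (sum_biUnion fun a _ b _ hab => disjoint_left.mpr fun w hw hw' => hab ?_).symm
        exact (mem_filter.mp hw).2.symm.trans (mem_filter.mp hw').2
    _ ≤ _ := by
        refine sum_le_sum_of_subset_of_nonneg (fun w hw => ?_) fun _ _ _ => by positivity
        obtain ⟨d, hd, hw⟩ := mem_biUnion.mp hw
        rw [mem_Icc] at hd
        refine mem_filter.mpr ⟨mem_univ _, ?_⟩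
        rintro rfl
        have := (mem_filter.mp hw).2
        rw [tdist_self] at this
        omega

/-- The normalizing factor satisfies `Z < 1 / (4 · ln(n/2))`. -/
theorem normalizing_factor_upper_bound :
    ∀ n : ℕ, 3 ≤ n → ∀ u : Vx n,
      Zfac n u < 1 / (4 * Real.log ((n : ℝ) / 2)) := by
  intro n hn u
  obtain ⟨k, hk, hk'⟩ : ∃ k, 2 * (k + 1) < n ∧ n ≤ 2 * (k + 2) :=
    ⟨(n - 1) / 2 - 1, by omega, by omega⟩
  have hn' : (3 : ℝ) ≤ n := by exact_mod_cast hn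
  have hle : (n : ℝ) ≤ 2 * (k + 2) := by exact_mod_cast hk'
  have hlog : 0 < Real.log ((n : ℝ) / 2) := Real.log_pos (by linarith)
  have hmono : Real.log ((n : ℝ) / 2) ≤ Real.log ((k : ℝ) + 2) :=
    Real.log_le_log (by linarith) (by linarith)
  have hharm := log_add_two_lt_sum_inv k
  have hsum := four_mul_sum_inv_le hk u
  rw [Zfac, ← one_div]
  exact one_div_lt_one_div_of_lt (by linarith) (by linarith)
end

section
/- For every integer n ≥ 3 and all distinct vertices u, v ∈ V, one has ∑_{w ∈ V, w ≠ u, w ≠ v} d(u,w)^{−2} · d(w,v)^{−2} < 12·ζ(3) + 4, where ζ(3) = ∑_{i=1}^∞ i^{−3}. -/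
open scoped Classical
open Finset

/-- `ζ(3) = ∑_{i ≥ 1} i⁻³`. -/
noncomputable def zeta3 : ℝ := ∑' i : ℕ, ((i + 1 : ℝ) ^ 3)⁻¹

theorem tdist_comm (n : ℕ) (u v : Vx n) : tdist n u v = tdist n v u := by
  unfold tdist
  omega

theorem card_circular_dist_eq_le (n a : ℕ) (c : Fin n) :
    #{x : Fin n | min ((c : ℤ) - (x : ℤ)).natAbs (n - ((c : ℤ) - (x : ℤ)).natAbs) = a} ≤ 2 := by
  rw [← card_map Fin.valEmbedding]
  refine (card_le_card (t := {if (c : ℕ) + a < n then (c : ℕ) + a else c + a - n,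
    if a ≤ (c : ℕ) then (c : ℕ) - a else c + n - a}) ?_).trans card_le_two
  intro y hy
  simp only [mem_map, mem_filter, mem_univ, true_and, Fin.valEmbedding_apply] at hy
  obtain ⟨x, hx, rfl⟩ := hy
  have hxn := x.isLt
  have hcn := c.isLt
  simp only [mem_insert, mem_singleton]
  split_ifs <;> omega

theorem card_tdist_eq_le (n i : ℕ) (u : Vx n) : #{w | tdist n u w = i} ≤ 4 * (i + 1) := by
  let A (c : Fin n) (a : ℕ) : Finset (Fin n) :=
    {x | min ((c : ℤ) - (x : ℤ)).natAbs (n - ((c : ℤ) - (x : ℤ)).natAbs) = a}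
  have hsub : ({w | tdist n u w = i} : Finset (Vx n)) ⊆
      (antidiagonal i).biUnion fun p => A u.1 p.1 ×ˢ A u.2 p.2 := by
    intro w hw
    simp only [mem_filter, mem_univ, true_and] at hw
    simp only [mem_biUnion, HasAntidiagonal.mem_antidiagonal, mem_product, A, mem_filter, mem_univ, true_and]
    exact ⟨(_, _), hw, rfl, rfl⟩
  have hcard := (card_le_card hsub).trans (card_biUnion_le_card_mul _ _ 4 fun p _ => by
    rw [card_product]
    exact Nat.mul_le_mul (card_circular_dist_eq_le n p.1 u.1) (card_circular_dist_eq_le n p.2 u.2))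
  rw [Finset.Nat.card_antidiagonal] at hcard
  omega

theorem zeta3_nonneg : 0 ≤ zeta3 := tsum_nonneg fun i => by positivity

theorem summable_inv_succ_cube : Summable fun i : ℕ => ((i + 1 : ℝ) ^ 3)⁻¹ := by
  have h := (summable_nat_add_iff 1).2 (Real.summable_nat_pow_inv.2 (by norm_num : 1 < 3))
  simpa using h

theorem sum_inv_tdist_pow_four_le (n : ℕ) (u : Vx n) :
    ∑ w, ((tdist n u w : ℝ) ^ 4)⁻¹ ≤ 8 * zeta3 := by
  have hmem : ∀ w ∈ (univ : Finset (Vx n)), tdist n u w ∈ range (2 * n + 1) := by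
    intro w _
    have h₁ := u.1.isLt
    have h₂ := w.1.isLt
    have h₃ := u.2.isLt
    have h₄ := w.2.isLt
    rw [mem_range, tdist]
    omega
  have hfiber (i : ℕ) : ∑ w with tdist n u w = i, ((tdist n u w : ℝ) ^ 4)⁻¹ =
      #{w | tdist n u w = i} * ((i : ℝ) ^ 4)⁻¹ := by
    rw [← nsmul_eq_mul]
    refine sum_eq_card_nsmul fun w hw => ?_
    rw [(mem_filter.1 hw).2]
  rw [← sum_fiberwise_of_maps_to hmem]
  simp only [hfiber]
  rw [sum_range_succ']
  calc _ ≤ ∑ i ∈ range (2 * n), 8 * ((i + 1 : ℝ) ^ 3)⁻¹ := by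
        simp only [Nat.cast_zero, ne_eq, OfNat.ofNat_ne_zero, not_false_eq_true, zero_pow,
          inv_zero, mul_zero, add_zero]
        refine sum_le_sum fun i _ => ?_
        have hcard : (#{w | tdist n u w = i + 1} : ℝ) ≤ 8 * (i + 1) := by
          exact_mod_cast (card_tdist_eq_le n (i + 1) u).trans (by omega)
        have hpos : (i + 1 : ℝ) ≠ 0 := by positivity
        calc _ ≤ 8 * (i + 1 : ℝ) * (((i + 1 : ℕ) : ℝ) ^ 4)⁻¹ := by gcongr
          _ = 8 * ((i + 1 : ℝ) ^ 3)⁻¹ := by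
            push_cast
            field_simp
    _ ≤ 8 * zeta3 := by
        rw [← mul_sum]
        gcongr
        exact summable_inv_succ_cube.sum_le_tsum _ fun i _ => by positivity

/-- `∑_{w ≠ u, w ≠ v} d(u,w)⁻² · d(w,v)⁻² < 12·ζ(3) + 4` for distinct vertices `u, v`. -/
theorem sum_inv_sq_dist_prod_lt :
    ∀ n : ℕ, 3 ≤ n → ∀ u v : Vx n, u ≠ v →
      (∑ w ∈ univ.filter (fun w => w ≠ u ∧ w ≠ v),
          ((tdist n u w : ℝ) ^ 2)⁻¹ * ((tdist n w v : ℝ) ^ 2)⁻¹) <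
        12 * zeta3 + 4 := by
  intro n _ u v _
  calc _ ≤ ∑ w ∈ univ.filter (fun w => w ≠ u ∧ w ≠ v),
        (((tdist n u w : ℝ) ^ 4)⁻¹ + ((tdist n v w : ℝ) ^ 4)⁻¹) / 2 := by
        refine sum_le_sum fun w _ => ?_
        rw [tdist_comm n w v]
        have h (x : ℝ) : (x ^ 4)⁻¹ = ((x ^ 2)⁻¹) ^ 2 := by
          rw [inv_pow, ← pow_mul]
        rw [h, h]
        linarith [two_mul_le_add_sq ((tdist n u w : ℝ) ^ 2)⁻¹ ((tdist n v w : ℝ) ^ 2)⁻¹]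
    _ ≤ ∑ w, (((tdist n u w : ℝ) ^ 4)⁻¹ + ((tdist n v w : ℝ) ^ 4)⁻¹) / 2 :=
        sum_le_sum_of_subset_of_nonneg (filter_subset _ _) fun _ _ _ => by positivity
    _ ≤ 8 * zeta3 := by
        rw [← sum_div, sum_add_distrib]
        linarith [sum_inv_tdist_pow_four_le n u, sum_inv_tdist_pow_four_le n v]
    _ < 12 * zeta3 + 4 := by linarith [zeta3_nonneg]
end
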